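/- Suppose that every residue R of type J with |J| = 2 (in either half C₊ or C₋) admits direct descent into R^θ and that R^θ is connected for every such R. Then for every residue Q (of any type, in either half): (a) Q admits direct descent into Q^θ, and (b) Q^θ inherits connectedness from Q, i.e., for every J ⊆ S and all chambers c, d ∈ Q^θ, if c and d are joined by a J-gallery in Q then they are joined by a J-gallery in Q^θ; in particular, Q^θ is connected. -/

import Mathlib

universe u v

/-- A twin building of type `(W,S)` (where `S` is the set of simple reflections of the
Coxeter system `cs`), with positive half `Cp` and negative half `Cm`, distance functions
`δp`, `δm`, codistance `δst : Cp × Cm → W`, `δts : Cm × Cp → W`, together with a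
quasi-flip: maps `θp : Cp → Cm`, `θm : Cm → Cp` inverse to each other and an automorphism
`π` of `W` with `π(S) = S`, `π ∘ π = id`, compatible with the distances and the
codistance. -/
structure QuasiFlipTwinBuilding {B : Type*} {W : Type*} [Group W]
    (M : CoxeterMatrix B) (cs : CoxeterSystem M W)
    (Cp : Type u) (Cm : Type v) where
  δp : Cp → Cp → W
  δm : Cm → Cm → W
  δst : Cp → Cm → W
  δts : Cm → Cp → W
  θp : Cp → Cm
  θm : Cm → Cp
  π : W ≃* W
  nonempty_p : Nonempty Cp
  nonempty_m : Nonempty Cm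
  /-- (Bu1) for the positive half -/
  p_eq_one_iff : ∀ x y : Cp, δp x y = 1 ↔ x = y
  /-- (Bu1) for the negative half -/
  m_eq_one_iff : ∀ x y : Cm, δm x y = 1 ↔ x = y
  /-- (Bu2) for the positive half -/
  p_two : ∀ (x y z : Cp) (s : W), s ∈ Set.range cs.simple → δp y z = s →
    δp x z = δp x y ∨ δp x z = δp x y * s
  p_two' : ∀ (x y z : Cp) (s : W), s ∈ Set.range cs.simple → δp y z = s →
    cs.length (δp x y * s) = cs.length (δp x y) + 1 → δp x z = δp x y * s
  /-- (Bu2) for the negative half -/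
  m_two : ∀ (x y z : Cm) (s : W), s ∈ Set.range cs.simple → δm y z = s →
    δm x z = δm x y ∨ δm x z = δm x y * s
  m_two' : ∀ (x y z : Cm) (s : W), s ∈ Set.range cs.simple → δm y z = s →
    cs.length (δm x y * s) = cs.length (δm x y) + 1 → δm x z = δm x y * s
  /-- (Bu3) for the positive half -/
  p_three : ∀ (x y : Cp) (s : W), s ∈ Set.range cs.simple →
    ∃ z : Cp, δp y z = s ∧ δp x z = δp x y * s
  /-- (Bu3) for the negative half -/
  m_three : ∀ (x y : Cm) (s : W), s ∈ Set.range cs.simple →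
    ∃ z : Cm, δm y z = s ∧ δm x z = δm x y * s
  /-- (Tw1) -/
  tw1 : ∀ (x : Cp) (y : Cm), δts y x = (δst x y)⁻¹
  /-- (Tw2), positive-to-negative -/
  tw2p : ∀ (x : Cp) (y z : Cm) (s : W), s ∈ Set.range cs.simple → δm y z = s →
    cs.length (δst x y * s) + 1 = cs.length (δst x y) → δst x z = δst x y * s
  /-- (Tw2), negative-to-positive -/
  tw2m : ∀ (x : Cm) (y z : Cp) (s : W), s ∈ Set.range cs.simple → δp y z = s →
    cs.length (δts x y * s) + 1 = cs.length (δts x y) → δts x z = δts x y * s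
  /-- (Tw3), positive-to-negative -/
  tw3p : ∀ (x : Cp) (y : Cm) (s : W), s ∈ Set.range cs.simple →
    ∃ z : Cm, δm y z = s ∧ δst x z = δst x y * s
  /-- (Tw3), negative-to-positive -/
  tw3m : ∀ (x : Cm) (y : Cp) (s : W), s ∈ Set.range cs.simple →
    ∃ z : Cp, δp y z = s ∧ δts x z = δts x y * s
  /-- `θ ∘ θ = id` -/
  θmθp : ∀ c : Cp, θm (θp c) = c
  θpθm : ∀ c : Cm, θp (θm c) = c
  /-- `π(S) = S` -/
  πS : ⇑π '' Set.range cs.simple = Set.range cs.simple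
  /-- `π ∘ π = id` -/
  ππ : ∀ w : W, π (π w) = w
  /-- `θ` interchanges the distances via `π` -/
  flip_p : ∀ x y : Cp, δm (θp x) (θp y) = π (δp x y)
  flip_m : ∀ x y : Cm, δp (θm x) (θm y) = π (δm x y)
  /-- `θ` preserves the codistance via `π` -/
  flip_st : ∀ (x : Cp) (z : Cm), δts (θp x) (θm z) = π (δst x z)
  flip_ts : ∀ (x : Cm) (z : Cp), δst (θm x) (θp z) = π (δts x z)

namespace QuasiFlipTwinBuilding

variable {B : Type*} {W : Type*} [Group W] {M : CoxeterMatrix B} {cs : CoxeterSystem M W}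
  {Cp : Type u} {Cm : Type v}

/-- The same twin building with a quasi-flip, with the roles of the two halves
interchanged. -/
def swap (T : QuasiFlipTwinBuilding M cs Cp Cm) : QuasiFlipTwinBuilding M cs Cm Cp where
  δp := T.δm
  δm := T.δp
  δst := T.δts
  δts := T.δst
  θp := T.θm
  θm := T.θp
  π := T.π
  nonempty_p := T.nonempty_m
  nonempty_m := T.nonempty_p
  p_eq_one_iff := T.m_eq_one_iff
  m_eq_one_iff := T.p_eq_one_iff
  p_two := T.m_two
  p_two' := T.m_two'
  m_two := T.p_two
  m_two' := T.p_two'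
  p_three := T.m_three
  m_three := T.p_three
  tw1 := fun x y => by rw [T.tw1 y x, inv_inv]
  tw2p := T.tw2m
  tw2m := T.tw2p
  tw3p := T.tw3m
  tw3m := T.tw3p
  θmθp := T.θpθm
  θpθm := T.θmθp
  πS := T.πS
  ππ := T.ππ
  flip_p := T.flip_m
  flip_m := T.flip_p
  flip_st := T.flip_ts
  flip_ts := T.flip_st

variable (T : QuasiFlipTwinBuilding M cs Cp Cm)

/-- The `θ`-codistance `δ^θ(c) = δ*(c, θ(c))` of a chamber of the positive half. -/
def δθ (c : Cp) : W := T.δst c (T.θp c)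

/-- The numerical `θ`-codistance `ℓ^θ(c) = ℓ(δ^θ(c))`. -/
noncomputable def ℓθ (c : Cp) : ℕ := cs.length (T.δθ c)

/-- The `s`-panel of a chamber `c`. -/
def panel (s : W) (c : Cp) : Set Cp := {d | T.δp c d = 1 ∨ T.δp c d = s}

/-- The `J`-residue of a chamber `c`. -/
def residue (J : Set W) (c : Cp) : Set Cp := {d | T.δp c d ∈ Subgroup.closure J}

/-- Opposition of chambers: `δ*(c,d) = 1`. -/
def Opp (c : Cp) (d : Cm) : Prop := T.δst c d = 1

/-- `R` is a Phan residue of type `J`: `R` is a `J`-residue, every chamber of `R` is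
opposite some chamber of `θ(R)`, and every chamber of `θ(R)` is opposite some chamber
of `R`. -/
def IsPhan (J : Set W) (R : Set Cp) : Prop :=
  (∃ c : Cp, R = T.residue J c) ∧
  (∀ r ∈ R, ∃ r' ∈ R, T.Opp r (T.θp r')) ∧
  (∀ r' ∈ R, ∃ r ∈ R, T.Opp r (T.θp r'))

/-- `R` is a minimal Phan residue of type `J`: it is a Phan residue containing no Phan
residue as a proper subset. -/
def IsMinPhan (J : Set W) (R : Set Cp) : Prop :=
  T.IsPhan J R ∧ ∀ (J' : Set W) (R' : Set Cp), J' ⊆ Set.range cs.simple →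
    T.IsPhan J' R' → R' ⊆ R → R' = R

/-- Two chambers are `J`-adjacent: they are `j`-adjacent for some `j ∈ J`. -/
def adjJ (J : Set W) (c d : Cp) : Prop := ∃ j ∈ J, T.δp c d = 1 ∨ T.δp c d = j

/-- There is a `J`-gallery from `c` to `d` all of whose chambers lie in `X`. -/
def GalleryIn (X : Set Cp) (J : Set W) (c d : Cp) : Prop :=
  ∃ γ : List Cp, γ.head? = some c ∧ γ.getLast? = some d ∧
    γ.Chain' (T.adjJ J) ∧ ∀ x ∈ γ, x ∈ X

/-- The flip-flop system of a set `R` of chambers: the chambers of `R` whose numerical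
`θ`-codistance is minimal among chambers of `R`. -/
def flipflop (R : Set Cp) : Set Cp := {c ∈ R | ∀ d ∈ R, T.ℓθ c ≤ T.ℓθ d}

/-- The flip-flop system `R^θ` is connected: any two of its chambers are joined by a
gallery all of whose chambers lie in `R^θ`. -/
def ConnectedFF (R : Set Cp) : Prop :=
  ∀ c ∈ T.flipflop R, ∀ d ∈ T.flipflop R,
    T.GalleryIn (T.flipflop R) (Set.range cs.simple) c d

/-- `R` admits direct descent into `R^θ`: from every chamber of `R` there is a gallery
within `R` ending in `R^θ` along which the numerical `θ`-codistance strictly decreases. -/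
def DirectDescent (R : Set Cp) : Prop :=
  ∀ c ∈ R, ∃ γ : List Cp, γ.head? = some c ∧
    (∃ e, γ.getLast? = some e ∧ e ∈ T.flipflop R) ∧
    γ.Chain' (T.adjJ (Set.range cs.simple)) ∧
    γ.Chain' (fun a b => T.ℓθ b < T.ℓθ a) ∧
    ∀ x ∈ γ, x ∈ R

/-- The quasi-flip is strong on this half: for every chamber `c` and every `s ∈ S` there
are chambers `d, x` in the `s`-panel of `c` with `ℓ(δ*(x, θ(d))) > ℓ(δ*(d, θ(d)))`,
i.e. the projection of `θ(d)` onto the panel is not `d`. -/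
def IsStrongHalf : Prop :=
  ∀ (c : Cp) (s : W), s ∈ Set.range cs.simple →
    ∃ d ∈ T.panel s c, ∃ x ∈ T.panel s c,
      cs.length (T.δst d (T.θp d)) < cs.length (T.δst x (T.θp d))

end QuasiFlipTwinBuilding

namespace CoxeterSystem

variable {B : Type*} {W : Type*} [Group W] {M : CoxeterMatrix B} (cs : CoxeterSystem M W)

open Classical in
/-- Conjugation by the simple reflection `s i`, together with a sign change at `s i`, on `W` with
signs in `ZMod 2`. -/
noncomputable def signedConj (i : B) : Function.End (W × ZMod 2) := fun p =>
  (cs.simple i * p.1 * cs.simple i, p.2 + if p.1 = cs.simple i then 1 else 0)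

open Classical in
theorem signedConj_mul_pow_apply (i j : B) (n : ℕ) (p : W × ZMod 2) :
    ((cs.signedConj i * cs.signedConj j) ^ n) p =
      ((cs.simple i * cs.simple j) ^ n * p.1 * ((cs.simple i * cs.simple j) ^ n)⁻¹,
        p.2 + ∑ l ∈ Finset.range (2 * n),
          if p.1 = cs.simple j * (cs.simple i * cs.simple j) ^ l then 1 else 0) := by
  set c := cs.simple i * cs.simple j with hc
  have hcomm : ∀ k : ℕ, (c ^ k)⁻¹ * cs.simple j = cs.simple j * c ^ k := by
    intro k
    have h1 : c⁻¹ = cs.simple j * c * (cs.simple j)⁻¹ := by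
      simp [hc, mul_assoc]
    rw [← inv_pow, h1, conj_pow]
    simp [mul_assoc]
  induction n with
  | zero =>
    simp only [pow_zero, Nat.mul_zero, Finset.range_zero, Finset.sum_empty, one_mul,
      inv_one, mul_one, add_zero]
    rfl
  | succ n ih =>
    have key1 : c ^ n * p.1 * (c ^ n)⁻¹ = cs.simple j ↔ p.1 = cs.simple j * c ^ (2 * n) := by
      rw [mul_inv_eq_iff_eq_mul, ← eq_inv_mul_iff_mul_eq, ← mul_assoc, hcomm, mul_assoc,
        ← pow_add, two_mul]
    have key2 : cs.simple j * (c ^ n * p.1 * (c ^ n)⁻¹) * cs.simple j = cs.simple i ↔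
        p.1 = cs.simple j * c ^ (2 * n + 1) := by
      have h2 : cs.simple j * (c ^ n * p.1 * (c ^ n)⁻¹) * cs.simple j = cs.simple i ↔
          c ^ n * p.1 * (c ^ n)⁻¹ = cs.simple j * c := by
        constructor
        · intro h
          have h' : cs.simple j * c = cs.simple j * cs.simple i * cs.simple j := by
            rw [hc, mul_assoc]
          rw [h', ← h]
          simp [mul_assoc]
        · intro h
          rw [h, hc]
          simp [mul_assoc]
      rw [h2, mul_inv_eq_iff_eq_mul, ← eq_inv_mul_iff_mul_eq, mul_assoc, ← mul_assoc _ (cs.simple j),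
        hcomm, mul_assoc, ← pow_succ', ← pow_add]
      congr! 3
      ring
    rw [pow_succ']
    change (cs.signedConj i) ((cs.signedConj j) (((cs.signedConj i * cs.signedConj j) ^ n) p)) = _
    rw [ih]
    simp only [signedConj, key1, key2]
    rw [show 2 * (n + 1) = 2 * n + 1 + 1 by ring, Finset.sum_range_succ, Finset.sum_range_succ]
    refine Prod.ext ?_ ?_
    · simp [pow_succ', hc, mul_assoc]
    · simp only [add_assoc]

theorem isLiftable_signedConj : M.IsLiftable cs.signedConj := by
  classical
  intro i j
  funext p
  have hp := cs.simple_mul_simple_pow i j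
  rw [signedConj_mul_pow_apply, hp]
  refine Prod.ext ?_ ?_
  · simp only [one_mul, inv_one, mul_one]
    rfl
  rw [two_mul, Finset.sum_range_add]
  simp only [pow_add, hp, one_mul]
  rw [CharTwo.add_self_eq_zero, add_zero]
  rfl

open Classical in
theorem lift_signedConj_wordProd_apply (ω : List B) (p : W × ZMod 2) :
    cs.lift ⟨cs.signedConj, cs.isLiftable_signedConj⟩ (cs.wordProd ω) p =
      (cs.wordProd ω * p.1 * (cs.wordProd ω)⁻¹, p.2 + (cs.rightInvSeq ω).count p.1) := by
  induction ω with
  | nil =>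
    simp only [wordProd_nil, map_one, one_mul, inv_one, mul_one, rightInvSeq_nil, List.count_nil,
      Nat.cast_zero, add_zero]
    rfl
  | cons i ω ih =>
    rw [wordProd_cons, map_mul, lift_apply_simple]
    change cs.signedConj i (cs.lift ⟨cs.signedConj, cs.isLiftable_signedConj⟩ (cs.wordProd ω) p) = _
    rw [ih]
    have h : cs.wordProd ω * p.1 * (cs.wordProd ω)⁻¹ = cs.simple i ↔
        (cs.wordProd ω)⁻¹ * cs.simple i * cs.wordProd ω = p.1 := by
      constructor
      · intro h; rw [← h]; group
      · intro h; rw [← h]; group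
    refine Prod.ext ?_ ?_
    · simp [signedConj, mul_assoc]
    · simp only [signedConj, rightInvSeq, List.count_cons, h, beq_iff_eq]
      push_cast
      rw [add_assoc]

/-- The exchange condition. -/
theorem simple_mem_rightInvSeq {ω : List B} {i : B} (h : cs.IsRightDescent (cs.wordProd ω) i) :
    cs.simple i ∈ cs.rightInvSeq ω := by
  classical
  obtain ⟨ω', hω', he⟩ := cs.exists_isReduced (cs.wordProd ω * cs.simple i)
  have hprod : cs.wordProd (ω'.concat i) = cs.wordProd ω := by
    rw [wordProd_concat, ← he]; simp
  have hred : cs.IsReduced (ω'.concat i) := by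
    have h1 := cs.isRightDescent_iff.mp h
    rw [IsReduced, hprod, ← h1, he, hω'.eq]
    simp
  have hcount : (cs.rightInvSeq (ω'.concat i)).count (cs.simple i) = 1 :=
    List.count_eq_one_of_mem hred.nodup_rightInvSeq (by rw [rightInvSeq_concat]; simp)
  have h1 := cs.lift_signedConj_wordProd_apply ω (cs.simple i, 0)
  rw [← hprod, lift_signedConj_wordProd_apply, hcount] at h1
  have h2 := congrArg Prod.snd h1
  by_contra hn
  rw [List.count_eq_zero_of_not_mem hn] at h2
  simp at h2

theorem exists_isReduced_of_mem_closure {J : Set W} (hJ : J ⊆ Set.range cs.simple) {w : W}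
    (hw : w ∈ Subgroup.closure J) :
    ∃ ω : List B, cs.IsReduced ω ∧ cs.wordProd ω = w ∧ ∀ i ∈ ω, cs.simple i ∈ J := by
  have step : ∀ (w : W) (i : B), cs.simple i ∈ J →
      (∃ ω : List B, cs.IsReduced ω ∧ cs.wordProd ω = w ∧ ∀ i ∈ ω, cs.simple i ∈ J) →
      ∃ ω : List B, cs.IsReduced ω ∧ cs.wordProd ω = w * cs.simple i ∧
        ∀ i ∈ ω, cs.simple i ∈ J := by
    rintro _ i hi ⟨ω, hω, rfl, hωJ⟩
    by_cases hd : cs.IsRightDescent (cs.wordProd ω) i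
    · obtain ⟨j, hj, hji⟩ := List.mem_iff_getElem.mp (cs.simple_mem_rightInvSeq hd)
      have hprod := cs.wordProd_mul_getD_rightInvSeq ω j
      rw [List.getD_eq_getElem _ 1 hj, hji] at hprod
      rw [cs.length_rightInvSeq] at hj
      refine ⟨ω.eraseIdx j, ?_, hprod.symm, fun k hk => hωJ k (List.mem_of_mem_eraseIdx hk)⟩
      have h1 := cs.isRightDescent_iff.mp hd
      have h2 := List.length_eraseIdx_add_one hj
      rw [hω.eq, hprod] at h1
      rw [IsReduced]
      omega
    · refine ⟨ω.concat i, ?_, cs.wordProd_concat i ω, ?_⟩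
      · rw [IsReduced, wordProd_concat, cs.not_isRightDescent_iff.mp hd, hω.eq]
        simp
      · intro k hk
        simp only [List.concat_eq_append, List.mem_append, List.mem_singleton] at hk
        rcases hk with hk | rfl
        · exact hωJ k hk
        · exact hi
  induction hw using Subgroup.closure_induction_right with
  | one => exact ⟨[], by simp [IsReduced], by simp, by simp⟩
  | mul_right x _ y hy ih =>
    obtain ⟨i, rfl⟩ := hJ hy
    exact step x i hy ih
  | mul_inv_cancel x _ y hy ih =>
    obtain ⟨i, rfl⟩ := hJ hy
    rw [inv_simple]
    exact step x i hy ih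

/-- A standard parabolic subgroup contains no simple reflections besides its generators. -/
theorem mem_of_mem_closure {J : Set W} (hJ : J ⊆ Set.range cs.simple) {s : W}
    (hs : s ∈ Set.range cs.simple) (h : s ∈ Subgroup.closure J) : s ∈ J := by
  obtain ⟨i, rfl⟩ := hs
  obtain ⟨ω, hω, hprod, hωJ⟩ := cs.exists_isReduced_of_mem_closure hJ h
  have h1 := hω.eq
  rw [hprod, length_simple] at h1
  obtain ⟨k, rfl⟩ := List.length_eq_one_iff.mp h1.symm
  rw [← hprod, wordProd_singleton]
  exact hωJ k (by simp)

theorem ne_one_of_mem_range_simple {s : W} (hs : s ∈ Set.range cs.simple) : s ≠ 1 := by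
  obtain ⟨i, rfl⟩ := hs
  intro h
  simpa [h] using cs.length_simple i

end CoxeterSystem

namespace QuasiFlipTwinBuilding

variable {B : Type*} {W : Type*} [Group W] {M : CoxeterMatrix B} {cs : CoxeterSystem M W}
  {Cp : Type u} {Cm : Type v} (T : QuasiFlipTwinBuilding M cs Cp Cm)

open Relation

theorem δp_self (x : Cp) : T.δp x x = 1 := (T.p_eq_one_iff x x).2 rfl

theorem δp_symm {x y : Cp} {s : W} (hs : s ∈ Set.range cs.simple) (h : T.δp x y = s) :
    T.δp y x = s := by
  have hs1 := cs.ne_one_of_mem_range_simple hs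
  have hss : s * s = 1 := by
    obtain ⟨i, rfl⟩ := hs
    simp
  rcases T.p_two y x y s hs h with h1 | h1
  · rw [δp_self] at h1
    rw [(T.p_eq_one_iff y x).1 h1.symm, δp_self] at h
    exact absurd h.symm hs1
  · rw [δp_self] at h1
    rw [eq_inv_of_mul_eq_one_left h1.symm, inv_eq_of_mul_eq_one_left hss]

theorem panel_trans {x y z : Cp} {s : W} (hs : s ∈ Set.range cs.simple)
    (hxy : T.δp x y = 1 ∨ T.δp x y = s) (hyz : T.δp y z = 1 ∨ T.δp y z = s) :
    T.δp x z = 1 ∨ T.δp x z = s := by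
  rcases hxy with hxy | hxy
  · rwa [(T.p_eq_one_iff x y).1 hxy]
  rcases hyz with hyz | hyz
  · rw [← (T.p_eq_one_iff y z).1 hyz]
    exact Or.inr hxy
  rcases T.p_two x y z s hs hyz with h | h
  · exact Or.inr (h.trans hxy)
  · left
    obtain ⟨i, rfl⟩ := hs
    rw [h, hxy, cs.simple_mul_simple_self]

variable {T}

theorem adjJ_symm {J : Set W} (hJ : J ⊆ Set.range cs.simple) {x y : Cp} (h : T.adjJ J x y) :
    T.adjJ J y x := by
  obtain ⟨j, hj, h | h⟩ := h
  · obtain rfl := (T.p_eq_one_iff x y).1 h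
    exact ⟨j, hj, Or.inl h⟩
  · exact ⟨j, hj, Or.inr (T.δp_symm (hJ hj) h)⟩

theorem adjJ_mono {J K : Set W} (hJK : J ⊆ K) {x y : Cp} (h : T.adjJ J x y) : T.adjJ K x y := by
  obtain ⟨j, hj, h⟩ := h
  exact ⟨j, hJK hj, h⟩

theorem δp_mem_closure_iff {J : Set W} (hJ : J ⊆ Set.range cs.simple) {x y : Cp} :
    T.δp x y ∈ Subgroup.closure J ↔ ReflTransGen (T.adjJ J) x y := by
  constructor
  · suffices ∀ w ∈ Subgroup.closure J, ∀ y, T.δp x y = w → ReflTransGen (T.adjJ J) x y from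
      fun h => this _ h _ rfl
    intro w hw
    have step : ∀ (w s : W), s ∈ J → (∀ y, T.δp x y = w → ReflTransGen (T.adjJ J) x y) →
        ∀ y, T.δp x y = w * s → ReflTransGen (T.adjJ J) x y := by
      intro w s hs ih y hy
      obtain ⟨z, hyz, hxz⟩ := T.p_three x y s (hJ hs)
      have hss : s * s = 1 := by
        obtain ⟨i, rfl⟩ := hJ hs
        simp
      rw [hy, mul_assoc, hss, mul_one] at hxz
      exact (ih z hxz).tail ⟨s, hs, Or.inr (T.δp_symm (hJ hs) hyz)⟩
    induction hw using Subgroup.closure_induction_right with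
    | one =>
      intro y hy
      rw [(T.p_eq_one_iff x y).1 hy]
    | mul_right w _ s hs ih => exact step w s hs ih
    | mul_inv_cancel w _ s hs ih =>
      obtain ⟨i, rfl⟩ := hJ hs
      rw [cs.inv_simple]
      exact step w _ hs ih
  · intro h
    induction h with
    | refl =>
      rw [δp_self]
      exact one_mem _
    | tail _ h ih =>
      rename_i y z _
      obtain ⟨j, hj, h | h⟩ := h
      · rwa [← (T.p_eq_one_iff y z).1 h]
      · rcases T.p_two x y z j (hJ hj) h with h' | h'
        · rwa [h']
        · rw [h']
          exact mul_mem ih (Subgroup.subset_closure hj)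

theorem self_mem_residue (J : Set W) (c : Cp) : c ∈ T.residue J c := by
  change T.δp c c ∈ Subgroup.closure J
  rw [δp_self]
  exact one_mem _

theorem mem_residue_of_mem {J : Set W} (hJ : J ⊆ Set.range cs.simple) {c x y : Cp}
    (hx : x ∈ T.residue J c) (hxy : T.δp x y ∈ Subgroup.closure J) : y ∈ T.residue J c :=
  (δp_mem_closure_iff hJ).2 (((δp_mem_closure_iff hJ).1 hx).trans ((δp_mem_closure_iff hJ).1 hxy))

theorem δp_mem_of_mem_residue {J : Set W} (hJ : J ⊆ Set.range cs.simple) {c x y : Cp}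
    (hx : x ∈ T.residue J c) (hy : y ∈ T.residue J c) : T.δp x y ∈ Subgroup.closure J := by
  have : Std.Symm (T.adjJ J) := ⟨fun _ _ => adjJ_symm hJ⟩
  have h := (δp_mem_closure_iff hJ).1 hx
  exact (δp_mem_closure_iff hJ).2
    ((symm h).trans
      ((δp_mem_closure_iff hJ).1 hy))

theorem residue_subset_residue {J K : Set W} (hJ : J ⊆ Set.range cs.simple)
    (hK : K ⊆ (Subgroup.closure J : Set W)) {c x : Cp} (hx : x ∈ T.residue J c) :
    T.residue K x ⊆ T.residue J c :=
  fun _ hy => mem_residue_of_mem hJ hx ((Subgroup.closure_le _).2 hK hy)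

theorem adjJ_of_mem_residue {J : Set W} (hJ : J ⊆ Set.range cs.simple) {c x y : Cp}
    (hx : x ∈ T.residue J c) (hy : y ∈ T.residue J c) (hxy : x ≠ y)
    (h : T.adjJ (Set.range cs.simple) x y) : T.adjJ J x y := by
  obtain ⟨s, hs, h | h⟩ := h
  · exact absurd ((T.p_eq_one_iff x y).1 h) hxy
  · exact ⟨s, cs.mem_of_mem_closure hJ hs (h ▸ δp_mem_of_mem_residue hJ hx hy), Or.inr h⟩

variable (T) in
/-- `J`-adjacency of two chambers of `X`. -/
def AdjIn (X : Set Cp) (J : Set W) (a b : Cp) : Prop := T.adjJ J a b ∧ a ∈ X ∧ b ∈ X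

theorem reflTransGen_adjIn_symm {X : Set Cp} {J : Set W} (hJ : J ⊆ Set.range cs.simple) {a b : Cp}
    (h : ReflTransGen (T.AdjIn X J) a b) : ReflTransGen (T.AdjIn X J) b a :=
  have : Std.Symm (T.AdjIn X J) := ⟨fun _ _ h => ⟨adjJ_symm hJ h.1, h.2.2, h.2.1⟩⟩
  symm h

theorem reflTransGen_adjIn_mono {X Y : Set Cp} {J K : Set W} (hXY : X ⊆ Y) (hJK : J ⊆ K)
    {a b : Cp} (h : ReflTransGen (T.AdjIn X J) a b) : ReflTransGen (T.AdjIn Y K) a b :=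
  ReflTransGen.mono (fun _ _ (h : T.AdjIn X J _ _) =>
    (⟨adjJ_mono hJK h.1, hXY h.2.1, hXY h.2.2⟩ : T.AdjIn Y K _ _)) _ _ h

theorem galleryIn_iff {X : Set Cp} {J : Set W} {c d : Cp} :
    T.GalleryIn X J c d ↔ c ∈ X ∧ ReflTransGen (T.AdjIn X J) c d := by
  constructor
  · rintro ⟨γ, hc, hd, hγ, hX⟩
    refine ⟨hX c (List.mem_of_mem_head? hc), ?_⟩
    induction γ generalizing c with
    | nil => simp at hc
    | cons a l ih =>
      obtain rfl : a = c := by simpa using hc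
      cases l with
      | nil =>
        obtain rfl : a = d := by simpa using hd
        exact .refl
      | cons b l =>
        have hγ' := List.isChain_cons_cons.1 hγ
        exact .head ⟨hγ'.1, hX a (by simp), hX b (by simp)⟩
          (ih rfl (by simpa using hd) hγ'.2 fun x hx => hX x (List.mem_cons_of_mem _ hx))
  · rintro ⟨hc, h⟩
    induction h using ReflTransGen.head_induction_on with
    | refl => exact ⟨[d], rfl, rfl, List.isChain_singleton d, by simpa using hc⟩
    | head h _ ih =>
      rename_i a b _
      obtain ⟨γ, hb, hd, hγ, hX⟩ := ih h.2.2
      refine ⟨a :: γ, rfl, ?_, ?_, ?_⟩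
      · rw [List.getLast?_cons, hd]
        rfl
      · refine List.isChain_cons.2 ⟨fun y hy => ?_, hγ⟩
        rw [hb] at hy
        obtain rfl : b = y := by simpa using hy
        exact h.1
      · simpa [hc] using hX

theorem directDescent_iff {R : Set Cp} :
    T.DirectDescent R ↔ ∀ x ∈ R, x ∉ T.flipflop R →
      ∃ y ∈ R, T.adjJ (Set.range cs.simple) x y ∧ T.ℓθ y < T.ℓθ x := by
  constructor
  · intro h x hx hxR
    obtain ⟨γ, hc, ⟨e, he, heR⟩, hadj, hlt, hR⟩ := h x hx
    match γ with
    | [] => simp at hc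
    | [a] =>
      simp only [List.head?_cons, Option.some.injEq, List.getLast?_singleton] at hc he
      subst hc he
      exact absurd heR hxR
    | a :: b :: l =>
      obtain rfl : a = x := by simpa using hc
      exact ⟨b, hR b (by simp), (List.isChain_cons_cons.1 hadj).1, (List.isChain_cons_cons.1 hlt).1⟩
  · intro h c hc
    induction hn : T.ℓθ c using Nat.strong_induction_on generalizing c with
    | _ n ih =>
      subst hn
      by_cases hcR : c ∈ T.flipflop R
      · exact ⟨[c], rfl, ⟨c, rfl, hcR⟩, List.isChain_singleton c, List.isChain_singleton c,
          by simpa using hc⟩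
      obtain ⟨d, hd, hadj, hlt⟩ := h c hc hcR
      obtain ⟨γ, hγd, ⟨e, he, heR⟩, hγ, hγ', hR⟩ := ih _ hlt d hd rfl
      refine ⟨c :: γ, rfl, ⟨e, ?_, heR⟩, ?_, ?_, by simpa [hc] using hR⟩
      · rw [List.getLast?_cons, he]
        rfl
      · refine List.isChain_cons.2 ⟨fun y hy => ?_, hγ⟩
        rw [hγd] at hy
        obtain rfl : d = y := by simpa using hy
        exact hadj
      · refine List.isChain_cons.2 ⟨fun y hy => ?_, hγ'⟩
        rw [hγd] at hy
        obtain rfl : d = y := by simpa using hy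
        exact hlt

variable (T) in
/-- The chambers of `Q` of numerical `θ`-codistance at most `n`. -/
def sublevel (Q : Set Cp) (n : ℕ) : Set Cp := {x ∈ Q | T.ℓθ x ≤ n}

theorem exists_lower_in_residue {J : Set W} {c : Cp} (hJ : J ⊆ Set.range cs.simple)
    (hD : T.DirectDescent (T.residue J c)) {x : Cp} (hx : x ∈ T.residue J c)
    (hx' : x ∉ T.flipflop (T.residue J c)) :
    ∃ y ∈ T.residue J c, T.adjJ J x y ∧ T.ℓθ y < T.ℓθ x := by
  obtain ⟨y, hy, hxy, hlt⟩ := directDescent_iff.1 hD x hx hx'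
  refine ⟨y, hy, adjJ_of_mem_residue hJ hx hy ?_ hxy, hlt⟩
  rintro rfl
  exact lt_irrefl _ hlt

theorem exists_descent_to_flipflop {J : Set W} {c : Cp} (hJ : J ⊆ Set.range cs.simple)
    (hD : T.DirectDescent (T.residue J c)) {n : ℕ} {x : Cp}
    (hx : x ∈ T.sublevel (T.residue J c) n) :
    ∃ e ∈ T.flipflop (T.residue J c),
      ReflTransGen (T.AdjIn (T.sublevel (T.residue J c) n) J) x e := by
  induction hm : T.ℓθ x using Nat.strong_induction_on generalizing x with
  | _ m ih =>
    subst hm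
    by_cases hxR : x ∈ T.flipflop (T.residue J c)
    · exact ⟨x, hxR, .refl⟩
    obtain ⟨y, hy, hxy, hlt⟩ := exists_lower_in_residue hJ hD hx.1 hxR
    have hy' : y ∈ T.sublevel (T.residue J c) n := ⟨hy, hlt.le.trans hx.2⟩
    obtain ⟨e, he, hye⟩ := ih _ hlt hy' rfl
    exact ⟨e, he, .head ⟨hxy, hx, hy'⟩ hye⟩

theorem reflTransGen_adjIn_sublevel {J : Set W} {c : Cp} (hJ : J ⊆ Set.range cs.simple)
    (hD : T.DirectDescent (T.residue J c)) (hC : T.ConnectedFF (T.residue J c)) {n : ℕ} {x z : Cp}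
    (hx : x ∈ T.sublevel (T.residue J c) n) (hz : z ∈ T.sublevel (T.residue J c) n) :
    ReflTransGen (T.AdjIn (T.sublevel (T.residue J c) n) J) x z := by
  obtain ⟨a, ha, hxa⟩ := exists_descent_to_flipflop hJ hD hx
  obtain ⟨b, hb, hzb⟩ := exists_descent_to_flipflop hJ hD hz
  refine (hxa.trans ?_).trans (reflTransGen_adjIn_symm hJ hzb)
  have hsub : T.flipflop (T.residue J c) ⊆ T.sublevel (T.residue J c) n :=
    fun u hu => ⟨hu.1, (hu.2 x hx.1).trans hx.2⟩
  have h := (galleryIn_iff.1 (hC a ha b hb)).2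
  clear hb hzb
  induction h with
  | refl => exact .refl
  | tail _ h ih =>
    rename_i u v _
    by_cases huv : u = v
    · exact huv ▸ ih
    · exact ih.tail ⟨adjJ_of_mem_residue hJ h.2.1.1 h.2.2.1 huv h.1, hsub h.2.1, hsub h.2.2⟩

/-- Let `x`, `y`, `z` be a gallery of type `(s, t)`, with `x` of level at most `n` and `z` of level
at most `n + 1`. Then `x` is joined to some chamber `{s, t}`-adjacent to `z` by an
`{s, t}`-gallery of levels at most `n`. -/
theorem reflTransGen_adjIn_of_peak
    (h2 : ∀ (J : Set W) (c : Cp), J ⊆ Set.range cs.simple → J.ncard = 2 →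
      T.DirectDescent (T.residue J c) ∧ T.ConnectedFF (T.residue J c))
    {J : Set W} {c : Cp} (hJ : J ⊆ Set.range cs.simple)
    {s t : W} (hs : s ∈ Set.range cs.simple) (ht : t ∈ Set.range cs.simple) (hst : s ≠ t)
    {n : ℕ} {x y z : Cp} (hx : x ∈ T.sublevel (T.residue J c) n)
    (hy : y ∈ T.residue J c)
    (hz : z ∈ T.sublevel (T.residue J c) (n + 1))
    (hxy : T.δp x y = s) (hyz : T.δp y z = t) :
    ∃ z', T.adjJ {s, t} z' z ∧
      z' ∈ T.sublevel (T.residue J c) n ∧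
      ReflTransGen (T.AdjIn (T.sublevel (T.residue J c) n) {s, t}) x z' := by
  have hK : ({s, t} : Set W) ⊆ Set.range cs.simple := by
    rintro u (rfl | rfl) <;> assumption
  have hKJ : ({s, t} : Set W) ⊆ (Subgroup.closure J : Set W) := by
    rintro u (rfl | rfl)
    · exact hxy ▸ δp_mem_of_mem_residue hJ hx.1 hy
    · exact hyz ▸ δp_mem_of_mem_residue hJ hy hz.1
  have hsub : T.residue {s, t} y ⊆ T.residue J c := residue_subset_residue hJ hKJ hy
  obtain ⟨hD, hC⟩ := h2 {s, t} y hK (Set.ncard_pair hst)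
  have hxR : x ∈ T.residue {s, t} y := by
    change T.δp y x ∈ Subgroup.closure {s, t}
    rw [T.δp_symm hs hxy]
    exact Subgroup.subset_closure (by simp)
  have hzR : z ∈ T.residue {s, t} y := by
    change T.δp y z ∈ Subgroup.closure {s, t}
    rw [hyz]
    exact Subgroup.subset_closure (by simp)
  have hlev : T.sublevel (T.residue {s, t} y) n ⊆ T.sublevel (T.residue J c) n :=
    fun u hu => ⟨hsub hu.1, hu.2⟩
  obtain ⟨z', hz', hadj⟩ : ∃ z' ∈ T.sublevel (T.residue {s, t} y) n, T.adjJ {s, t} z' z := by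
    by_cases hzn : T.ℓθ z ≤ n
    · exact ⟨z, ⟨hzR, hzn⟩, s, by simp, Or.inl (T.δp_self z)⟩
    · have hzR' : z ∉ T.flipflop (T.residue {s, t} y) := fun h =>
        hzn ((h.2 x hxR).trans hx.2)
      obtain ⟨z', hz', hadj, hlt⟩ := exists_lower_in_residue hK hD hzR hzR'
      exact ⟨z', ⟨hz', Nat.lt_succ_iff.1 (hlt.trans_le hz.2)⟩, adjJ_symm hK hadj⟩
  exact ⟨z', hadj, hlev hz', reflTransGen_adjIn_mono hlev subset_rfl
    (reflTransGen_adjIn_sublevel hK hD hC ⟨hxR, hx.2⟩ hz')⟩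

theorem reflTransGen_adjIn_sublevel_of_succ
    (h2 : ∀ (J : Set W) (c : Cp), J ⊆ Set.range cs.simple → J.ncard = 2 →
      T.DirectDescent (T.residue J c) ∧ T.ConnectedFF (T.residue J c))
    {J K : Set W} {c : Cp} (hJ : J ⊆ Set.range cs.simple) (hK : K ⊆ Set.range cs.simple)
    {n : ℕ} {a b : Cp} (ha : a ∈ T.sublevel (T.residue J c) n)
    (hb : b ∈ T.sublevel (T.residue J c) n)
    (h : ReflTransGen (T.AdjIn (T.sublevel (T.residue J c) (n + 1)) K) a b) :
    ReflTransGen (T.AdjIn (T.sublevel (T.residue J c) n) K) a b := by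
  suffices key : ∀ x ∈ T.sublevel (T.residue J c) n, T.adjJ K x a →
      ReflTransGen (T.AdjIn (T.sublevel (T.residue J c) n) K) x b by
    rcases h.cases_head with rfl | ⟨y, hy, _⟩
    · exact .refl
    · obtain ⟨j, hj, _⟩ := hy.1
      exact key a ha ⟨j, hj, Or.inl (T.δp_self a)⟩
  clear ha
  induction h using ReflTransGen.head_induction_on with
  | refl => exact fun x hx hxb => .single ⟨hxb, hx, hb⟩
  | head h _ ih =>
    rename_i y z _
    intro x hx hxy
    obtain ⟨hyz, hy, hz⟩ := h
    by_cases hyn : T.ℓθ y ≤ n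
    · exact .head ⟨hxy, hx, hy.1, hyn⟩ (ih y ⟨hy.1, hyn⟩ hyz)
    obtain ⟨s, hsK, hs⟩ := hxy
    obtain ⟨t, htK, ht⟩ := hyz
    by_cases hst : s = t
    · subst hst
      exact ih x hx ⟨s, hsK, T.panel_trans (hK hsK) hs ht⟩
    rcases ht with ht | ht
    · obtain rfl := (T.p_eq_one_iff y z).1 ht
      exact ih x hx ⟨s, hsK, hs⟩
    rcases hs with hs | hs
    · obtain rfl := (T.p_eq_one_iff x y).1 hs
      exact absurd hx.2 hyn
    have hstK : ({s, t} : Set W) ⊆ K := by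
      rintro u (rfl | rfl) <;> assumption
    obtain ⟨z', hadj, hz', hxz'⟩ := reflTransGen_adjIn_of_peak h2 hJ (hK hsK) (hK htK) hst hx hy.1
      hz hs ht
    exact (reflTransGen_adjIn_mono subset_rfl hstK hxz').trans (ih z' hz' (adjJ_mono hstK hadj))

theorem reflTransGen_adjIn_sublevel_of_reflTransGen_adjIn
    (h2 : ∀ (J : Set W) (c : Cp), J ⊆ Set.range cs.simple → J.ncard = 2 →
      T.DirectDescent (T.residue J c) ∧ T.ConnectedFF (T.residue J c))
    {J K : Set W} {c : Cp} (hJ : J ⊆ Set.range cs.simple) (hK : K ⊆ Set.range cs.simple)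
    {n : ℕ} {a b : Cp} (ha : a ∈ T.sublevel (T.residue J c) n)
    (hb : b ∈ T.sublevel (T.residue J c) n)
    (h : ReflTransGen (T.AdjIn (T.residue J c) K) a b) :
    ReflTransGen (T.AdjIn (T.sublevel (T.residue J c) n) K) a b := by
  obtain ⟨N, hnN, hN⟩ : ∃ N, n ≤ N ∧
      ReflTransGen (T.AdjIn (T.sublevel (T.residue J c) N) K) a b := by
    clear hb
    induction h with
    | refl => exact ⟨n, le_rfl, .refl⟩
    | tail _ h ih =>
      rename_i u v _
      obtain ⟨N, hnN, hN⟩ := ih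
      refine ⟨max N (max (T.ℓθ u) (T.ℓθ v)), hnN.trans (le_max_left _ _), ?_⟩
      refine (reflTransGen_adjIn_mono (fun x hx => ?_) subset_rfl hN).tail
        ⟨h.1, ⟨h.2.1, ?_⟩, ⟨h.2.2, ?_⟩⟩
      · exact ⟨hx.1, hx.2.trans (le_max_left _ _)⟩
      · simp
      · simp
  induction N, hnN using Nat.le_induction with
  | base => exact hN
  | succ N hnN ih =>
    exact ih (reflTransGen_adjIn_sublevel_of_succ h2 hJ hK ⟨ha.1, ha.2.trans hnN⟩
      ⟨hb.1, hb.2.trans hnN⟩ hN)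

theorem reflTransGen_adjIn_residue {J : Set W} (hJ : J ⊆ Set.range cs.simple) {c a b : Cp}
    (ha : a ∈ T.residue J c) (hb : b ∈ T.residue J c) :
    ReflTransGen (T.AdjIn (T.residue J c) J) a b := by
  have h := (δp_mem_closure_iff hJ).1 (δp_mem_of_mem_residue hJ ha hb)
  clear hb
  induction h with
  | refl => exact .refl
  | tail h h' ih =>
    exact ih.tail ⟨h', mem_residue_of_mem hJ ha ((δp_mem_closure_iff hJ).2 h),
      mem_residue_of_mem hJ ha ((δp_mem_closure_iff hJ).2 (h.tail h'))⟩

theorem directDescent_residue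
    (h2 : ∀ (J : Set W) (c : Cp), J ⊆ Set.range cs.simple → J.ncard = 2 →
      T.DirectDescent (T.residue J c) ∧ T.ConnectedFF (T.residue J c))
    {J : Set W} (c : Cp) (hJ : J ⊆ Set.range cs.simple) : T.DirectDescent (T.residue J c) := by
  rw [directDescent_iff]
  intro x hx hxQ
  obtain ⟨e, he, hlt⟩ : ∃ e ∈ T.residue J c, T.ℓθ e < T.ℓθ x := by
    by_contra! h
    exact hxQ ⟨hx, h⟩
  have h := reflTransGen_adjIn_sublevel_of_reflTransGen_adjIn h2 hJ hJ ⟨hx, le_rfl⟩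
    ⟨he, hlt.le⟩ (reflTransGen_adjIn_residue hJ hx he)
  suffices key : ∀ n, ReflTransGen (T.AdjIn (T.sublevel (T.residue J c) n) J) x e →
      T.ℓθ e < n → T.ℓθ x = n →
      ∃ y ∈ T.residue J c, T.adjJ (Set.range cs.simple) x y ∧ T.ℓθ y < n from
    key _ h hlt rfl
  clear h hlt hxQ hx
  intro n h hen
  induction h using ReflTransGen.head_induction_on with
  | refl => exact fun h => absurd h hen.ne
  | head h _ ih =>
    rename_i y z _
    intro hyn
    obtain ⟨hyz, hy, hz⟩ := h
    rcases hz.2.lt_or_eq with hzn | hzn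
    · exact ⟨z, hz.1, adjJ_mono hJ hyz, hzn⟩
    obtain ⟨u, hu, ⟨s, hs, hzu⟩, hun⟩ := ih hzn
    obtain ⟨t, htJ, ht⟩ := hyz
    by_cases hst : s = t
    · subst hst
      exact ⟨u, hu, ⟨s, hs, T.panel_trans hs ht hzu⟩, hun⟩
    rcases ht with ht | ht
    · obtain rfl := (T.p_eq_one_iff y z).1 ht
      exact ⟨u, hu, ⟨s, hs, hzu⟩, hun⟩
    rcases hzu with hzu | hzu
    · obtain rfl := (T.p_eq_one_iff z u).1 hzu
      exact absurd hzn hun.ne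
    have hK : ({s, t} : Set W) ⊆ Set.range cs.simple := by
      rintro u (rfl | rfl)
      exacts [hs, hJ htJ]
    have hKJ : ({s, t} : Set W) ⊆ (Subgroup.closure J : Set W) := by
      rintro u (rfl | rfl)
      · exact hzu ▸ δp_mem_of_mem_residue hJ hz.1 hu
      · exact Subgroup.subset_closure htJ
    have hyR : y ∈ T.residue {s, t} z := by
      change T.δp z y ∈ Subgroup.closure {s, t}
      rw [T.δp_symm (hJ htJ) ht]
      exact Subgroup.subset_closure (by simp)
    have huR : u ∈ T.residue {s, t} z := by
      change T.δp z u ∈ Subgroup.closure {s, t}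
      rw [hzu]
      exact Subgroup.subset_closure (by simp)
    obtain ⟨v, hv, hadj, hlt⟩ := exists_lower_in_residue hK
      (h2 {s, t} z hK (Set.ncard_pair hst)).1 hyR
      fun h => absurd (h.2 u huR) (not_le.2 (hyn ▸ hun))
    exact ⟨v, residue_subset_residue hJ hKJ hz.1 hv, adjJ_mono hK hadj, hyn ▸ hlt⟩

theorem galleryIn_flipflop_residue
    (h2 : ∀ (J : Set W) (c : Cp), J ⊆ Set.range cs.simple → J.ncard = 2 →
      T.DirectDescent (T.residue J c) ∧ T.ConnectedFF (T.residue J c))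
    {J K : Set W} {c a b : Cp} (hJ : J ⊆ Set.range cs.simple) (hK : K ⊆ Set.range cs.simple)
    (ha : a ∈ T.flipflop (T.residue J c)) (hb : b ∈ T.flipflop (T.residue J c))
    (h : T.GalleryIn (T.residue J c) K a b) :
    T.GalleryIn (T.flipflop (T.residue J c)) K a b :=
  galleryIn_iff.2 ⟨ha, reflTransGen_adjIn_mono
    (fun x (hx : x ∈ T.sublevel (T.residue J c) (T.ℓθ a)) =>
      show x ∈ T.flipflop _ from ⟨hx.1, fun d hd => hx.2.trans (ha.2 d hd)⟩)
    subset_rfl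
    (reflTransGen_adjIn_sublevel_of_reflTransGen_adjIn h2 hJ hK ⟨ha.1, le_rfl⟩
      ⟨hb.1, hb.2 a ha.1⟩ (galleryIn_iff.1 h).2)⟩

theorem connectedFF_residue
    (h2 : ∀ (J : Set W) (c : Cp), J ⊆ Set.range cs.simple → J.ncard = 2 →
      T.DirectDescent (T.residue J c) ∧ T.ConnectedFF (T.residue J c))
    {J : Set W} (c : Cp) (hJ : J ⊆ Set.range cs.simple) : T.ConnectedFF (T.residue J c) :=
  fun _ ha _ hb => galleryIn_flipflop_residue h2 hJ subset_rfl ha hb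
    (galleryIn_iff.2 ⟨ha.1, reflTransGen_adjIn_mono subset_rfl hJ
      (reflTransGen_adjIn_residue hJ ha.1 hb.1)⟩)

end QuasiFlipTwinBuilding

open QuasiFlipTwinBuilding in
/-- Suppose every rank-two residue `R` (in either half) admits direct descent into a
connected `R^θ`.  Then every residue `Q` (of any type, in either half) admits direct
descent into `Q^θ`, and `Q^θ` inherits connectedness from `Q`: any two chambers of `Q^θ`
joined by a `J`-gallery in `Q` are joined by a `J`-gallery in `Q^θ`; in particular `Q^θ`
is connected. -/
theorem local_to_global_descent
    {B : Type*} {W : Type*} [Group W] {M : CoxeterMatrix B} {cs : CoxeterSystem M W}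
    {Cp : Type u} {Cm : Type v} (T : QuasiFlipTwinBuilding M cs Cp Cm)
    (h2p : ∀ (J : Set W) (c : Cp), J ⊆ Set.range cs.simple → J.ncard = 2 →
      T.DirectDescent (T.residue J c) ∧ T.ConnectedFF (T.residue J c))
    (h2m : ∀ (J : Set W) (c : Cm), J ⊆ Set.range cs.simple → J.ncard = 2 →
      T.swap.DirectDescent (T.swap.residue J c) ∧ T.swap.ConnectedFF (T.swap.residue J c)) :
    (∀ (J : Set W) (c : Cp), J ⊆ Set.range cs.simple →
      T.DirectDescent (T.residue J c) ∧
      (∀ J' : Set W, J' ⊆ Set.range cs.simple →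
        ∀ a ∈ T.flipflop (T.residue J c), ∀ b ∈ T.flipflop (T.residue J c),
          T.GalleryIn (T.residue J c) J' a b →
          T.GalleryIn (T.flipflop (T.residue J c)) J' a b) ∧
      T.ConnectedFF (T.residue J c)) ∧
    (∀ (J : Set W) (c : Cm), J ⊆ Set.range cs.simple →
      T.swap.DirectDescent (T.swap.residue J c) ∧
      (∀ J' : Set W, J' ⊆ Set.range cs.simple →
        ∀ a ∈ T.swap.flipflop (T.swap.residue J c),
        ∀ b ∈ T.swap.flipflop (T.swap.residue J c),
          T.swap.GalleryIn (T.swap.residue J c) J' a b →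
          T.swap.GalleryIn (T.swap.flipflop (T.swap.residue J c)) J' a b) ∧
      T.swap.ConnectedFF (T.swap.residue J c)) := by
  exact ⟨fun _ c hJ => ⟨directDescent_residue h2p c hJ,
      fun _ hK _ ha _ hb => galleryIn_flipflop_residue h2p hJ hK ha hb,
      connectedFF_residue h2p c hJ⟩,
    fun _ c hJ => ⟨directDescent_residue h2m c hJ,
      fun _ hK _ ha _ hb => galleryIn_flipflop_residue h2m hJ hK ha hb,
      connectedFF_residue h2m c hJ⟩⟩
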